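/- Under the stability assumptions (y₀ = y₋₁ + Σ(Ax₀ − b^δ), (x*,y*) ∈ S*, ‖b^δ − b*‖ ≤ δ, 0 ≤ ε_k ≤ C₀δ, ω := 1 − τ_M(L + σ_M‖A‖²) ≥ 0, and existence of ξ ∈ (0,1), η > 1 with ξ − τ_M(ξL + σ_M‖A‖²) ≥ 0 and σ_m(η−1) − σ_Mξη > 0), for every C̃ > 0 there exist constants C, C′, C″ ≥ 0, independent of δ, such that for every δ ∈ (0, C̃], taking the early stopping time k = ⌈C̃/δ⌉, the averaged iterates satisfy L_{b*}(x̂_k, y*) − L_{b*}(x*, ŷ_k) ≤ Cδ and ‖Ax̂_k − b*‖² ≤ C′δ + C″δ². -/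

import Mathlib

open scoped RealInnerProductSpace ENNReal NNReal
open Filter Topology

noncomputable section

/-- The `ε`-subdifferential of an extended-real-valued function `R` at `x`:
`∂_ε R (x) = {u : ∀ x', R x - R x' ≤ ⟪u, x - x'⟫ + ε}`, written without `EReal` subtraction. -/
def epsSubdiff {X : Type*} [NormedAddCommGroup X] [InnerProductSpace ℝ X]
    (R : X → EReal) (ε : ℝ) (x : X) : Set X :=
  {u | ∀ x' : X, R x + ((⟪u, x' - x⟫ - ε : ℝ) : EReal) ≤ R x'}

/-- Convexity for extended-real-valued functions. -/
def ERealConvex {X : Type*} [AddCommGroup X] [Module ℝ X] (R : X → EReal) : Prop :=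
  ∀ x y : X, ∀ t : ℝ, 0 ≤ t → t ≤ 1 →
    R (t • x + (1 - t) • y) ≤ (t : EReal) * R x + ((1 - t : ℝ) : EReal) * R y

/-- `R` is proper, convex and lower semicontinuous. -/
def ProperConvexLsc {X : Type*} [NormedAddCommGroup X] [InnerProductSpace ℝ X]
    (R : X → EReal) : Prop :=
  (∃ x, R x ≠ ⊤) ∧ (∀ x, R x ≠ ⊥) ∧ ERealConvex R ∧ LowerSemicontinuous R

/-- The Lagrangian `L_b(x,y) = R x + F x + ⟪y, A x - b⟫`. -/
def Lag {X Y : Type*} [NormedAddCommGroup X] [InnerProductSpace ℝ X]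
    [NormedAddCommGroup Y] [InnerProductSpace ℝ Y]
    (R : X → EReal) (F : X → ℝ) (A : X →L[ℝ] Y) (b : Y) (x : X) (y : Y) : EReal :=
  R x + ((F x + ⟪y, A x - b⟫ : ℝ) : EReal)

/-- Saddle points of the Lagrangian `L_b`. -/
def IsSaddle {X Y : Type*} [NormedAddCommGroup X] [InnerProductSpace ℝ X]
    [NormedAddCommGroup Y] [InnerProductSpace ℝ Y]
    (R : X → EReal) (F : X → ℝ) (A : X →L[ℝ] Y) (b : Y) (p : X × Y) : Prop :=
  ∀ x : X, ∀ y : Y, Lag R F A b p.1 y ≤ Lag R F A b x p.2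

/-- Weak convergence of a sequence in a Hilbert space. -/
def WeakTendsto {X : Type*} [NormedAddCommGroup X] [InnerProductSpace ℝ X]
    (u : ℕ → X) (l : X) : Prop :=
  ∀ w : X, Tendsto (fun k => ⟪u k, w⟫) atTop (nhds ⟪l, w⟫)

/-- `V(x,y) = ½‖x‖_T² + ½‖y‖_Σ²`, written via the inverses of the preconditioners. -/
def Vfun {X Y : Type*} [NormedAddCommGroup X] [InnerProductSpace ℝ X]
    [NormedAddCommGroup Y] [InnerProductSpace ℝ Y]
    (Tinv : X →L[ℝ] X) (Sginv : Y →L[ℝ] Y) (z : X × Y) : ℝ :=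
  1 / 2 * ⟪Tinv z.1, z.1⟫ + 1 / 2 * ⟪Sginv z.2, z.2⟫

variable {X Y : Type*}
  [NormedAddCommGroup X] [InnerProductSpace ℝ X] [CompleteSpace X]
  [NormedAddCommGroup Y] [InnerProductSpace ℝ Y] [CompleteSpace Y]

/-- The descent lemma for a function whose gradient is `L`-Lipschitz. -/
lemma le_add_inner_add_sq_of_lipschitz_gradient {E : Type*} [NormedAddCommGroup E]
    [InnerProductSpace ℝ E] [CompleteSpace E] {f : E → ℝ} {f' : E → E} {L : ℝ}
    (hf : ∀ u, HasGradientAt f (f' u) u) (hlip : ∀ u v, ‖f' u - f' v‖ ≤ L * ‖u - v‖) (u v : E) :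
    f v ≤ f u + ⟪f' u, v - u⟫ + L / 2 * ‖v - u‖ ^ 2 := by
  set d := v - u with hd
  have hder : ∀ t : ℝ, HasDerivAt
      (fun t : ℝ => f (u + t • d) - t * ⟪f' u, d⟫ - L / 2 * ‖d‖ ^ 2 * t ^ 2)
      (⟪f' (u + t • d), d⟫ - ⟪f' u, d⟫ - L * ‖d‖ ^ 2 * t) t := by
    intro t
    have hline : HasDerivAt (fun t : ℝ => u + t • d) d t := by
      simpa using ((hasDerivAt_id t).smul_const d).const_add u
    have hcomp : HasDerivAt (fun t : ℝ => f (u + t • d)) ⟪f' (u + t • d), d⟫ t := by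
      simpa [Function.comp_def] using! (hf (u + t • d)).hasFDerivAt.comp_hasDerivAt t hline
    refine ((hcomp.sub ((hasDerivAt_id t).mul_const ⟪f' u, d⟫)).sub
      (((hasDerivAt_id t).pow 2).const_mul (L / 2 * ‖d‖ ^ 2))).congr_deriv ?_
    simp
    ring
  have hanti := antitoneOn_of_deriv_nonpos (convex_Icc (0 : ℝ) 1)
    (fun t _ => (hder t).continuousAt.continuousWithinAt)
    (fun t _ => (hder t).differentiableAt.differentiableWithinAt) (by
      intro t ht
      rw [interior_Icc] at ht
      rw [(hder t).deriv, ← inner_sub_left]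
      have h1 := real_inner_le_norm (f' (u + t • d) - f' u) d
      have h2 := hlip (u + t • d) u
      rw [add_sub_cancel_left, norm_smul, Real.norm_of_nonneg ht.1.le] at h2
      nlinarith [mul_le_mul_of_nonneg_right h2 (norm_nonneg d)])
  have h01 := hanti (Set.left_mem_Icc.2 zero_le_one) (Set.right_mem_Icc.2 zero_le_one) zero_le_one
  have huv : u + (1 : ℝ) • d = v := by simp [hd]
  simp only [huv] at h01
  simp at h01
  linarith

/-- The gradient inequality for a differentiable convex function. -/
lemma ConvexOn.add_inner_gradient_le {E : Type*} [NormedAddCommGroup E]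
    [InnerProductSpace ℝ E] [CompleteSpace E] {f : E → ℝ} (hconv : ConvexOn ℝ Set.univ f)
    {u g : E} (hf : HasGradientAt f g u) (v : E) :
    f u + ⟪g, v - u⟫ ≤ f v := by
  have hline : HasDerivAt (fun t : ℝ => AffineMap.lineMap u v t) (v - u) 0 :=
    AffineMap.hasDerivAt_lineMap
  have hf0 : HasGradientAt f g (AffineMap.lineMap u v (0 : ℝ)) := by simpa using hf
  have hder : HasDerivAt (fun t : ℝ => f (AffineMap.lineMap u v t)) ⟪g, v - u⟫ 0 := by
    simpa [Function.comp_def] using! hf0.hasFDerivAt.comp_hasDerivAt (0 : ℝ) hline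
  have hc : ConvexOn ℝ Set.univ (fun t : ℝ => f (AffineMap.lineMap u v t)) := by
    simpa using! hconv.comp_affineMap (AffineMap.lineMap u v : ℝ →ᵃ[ℝ] E)
  have h := hc.le_slope_of_hasDerivAt (Set.mem_univ 0) (Set.mem_univ 1) zero_lt_one hder
  simp [slope_def_field] at h
  linarith

/-- A form bound `⟪S u, u⟫ ≤ M‖u‖²` on a positive symmetric operator bounds `‖S u‖²` by
`M⟪S u, u⟫`. -/
lemma norm_sq_apply_le_of_form_le {E : Type*} [NormedAddCommGroup E] [InnerProductSpace ℝ E]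
    {S : E →L[ℝ] E} (hsymm : ∀ u v : E, ⟪S u, v⟫ = ⟪u, S v⟫) {M : ℝ} (hM : 0 < M)
    (hpos : ∀ u : E, 0 ≤ ⟪S u, u⟫) (hle : ∀ u : E, ⟪S u, u⟫ ≤ M * ‖u‖ ^ 2) (u : E) :
    ‖S u‖ ^ 2 ≤ M * ⟪S u, u⟫ := by
  have h := hpos (M • u - S u)
  have h2 := hle (S u)
  have h3 : ⟪S (S u), u⟫ = ‖S u‖ ^ 2 := by rw [hsymm, real_inner_self_eq_norm_sq]
  simp only [map_sub, map_smul, inner_sub_left, inner_sub_right, real_inner_smul_left,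
    real_inner_smul_right, h3, real_inner_self_eq_norm_sq] at h
  nlinarith

/-- Three-point identity for the quadratic form of a symmetric operator. -/
lemma inner_apply_sub_eq_three_point {E : Type*} [NormedAddCommGroup E] [InnerProductSpace ℝ E]
    {S : E →L[ℝ] E} (hsymm : ∀ u v : E, ⟪S u, v⟫ = ⟪u, S v⟫) (a b : E) :
    ⟪S (a - b), a⟫ = 1 / 2 * ⟪S a, a⟫ - 1 / 2 * ⟪S b, b⟫ + 1 / 2 * ⟪S (a - b), a - b⟫ := by
  have h : ⟪S b, a⟫ = ⟪S a, b⟫ := by rw [hsymm, real_inner_comm]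
  simp only [map_sub, inner_sub_left, inner_sub_right, h]
  ring

/-- One step of the primal-dual iteration decreases the energy `Vfun`, up to the subdifferential
error and the data error. Here `z`, `z₁`, `z₂` are three consecutive dual iterates. -/
lemma primalDual_energy_step
    {A : X →L[ℝ] Y} {F : X → ℝ} {F' : X → X} {L : ℝ}
    (hFconv : ConvexOn ℝ Set.univ F)
    (hFgrad : ∀ u : X, HasGradientAt F (F' u) u)
    (hFlip : ∀ u v : X, ‖F' u - F' v‖ ≤ L * ‖u - v‖)
    {Tinv : X →L[ℝ] X} {Sg Sginv : Y →L[ℝ] Y}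
    (hSginv : ∀ v, Sginv (Sg v) = v)
    (hTsa : ∀ u v : X, ⟪Tinv u, v⟫ = ⟪u, Tinv v⟫)
    (hSgsa : ∀ u v : Y, ⟪Sg u, v⟫ = ⟪u, Sg v⟫)
    (hSginvsa : ∀ u v : Y, ⟪Sginv u, v⟫ = ⟪u, Sginv v⟫)
    (hbracket : ∀ u : X, L * ‖u‖ ^ 2 + ⟪Sg (A u), A u⟫ ≤ ⟪Tinv u, u⟫)
    {xs x x' : X} {ys z z₁ z₂ b : Y} {r' rs ε : ℝ}
    (hz₁ : z₁ = z + Sg (A x - b)) (hz₂ : z₂ = z₁ + Sg (A x' - b))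
    (hsub : r' + (⟪-(Tinv (x' - x)) - F' x
      - ContinuousLinearMap.adjoint A ((2 : ℝ) • z₁ - z), xs - x'⟫ - ε) ≤ rs) :
    (r' + F x' + ⟪ys, A x' - A xs⟫ - rs - F xs) + Vfun Tinv Sginv (x' - xs, z₂ - ys)
        + 1 / 2 * ⟪Sg (A x - b), A x - b⟫
      ≤ Vfun Tinv Sginv (x - xs, z₁ - ys) + ε + ⟪ys - ((2 : ℝ) • z₁ - z), b - A xs⟫ := by
  have hdesc := le_add_inner_add_sq_of_lipschitz_gradient hFgrad hFlip x x'
  have hgrad := hFconv.add_inner_gradient_le (hFgrad x) xs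
  have hT := inner_apply_sub_eq_three_point hTsa (x' - xs) (x - xs)
  rw [sub_sub_sub_cancel_right] at hT
  set d := A x - b with hd
  set d' := A x' - b with hd'
  have hdd : d' - d = A (x' - x) := by simp [hd, hd']
  have hbr := hbracket (x' - x)
  rw [← hdd] at hbr
  set w := (2 : ℝ) • z₁ - z with hw
  have hw' : w = z₁ + Sg d := by rw [hw, two_smul, hz₁]; abel
  have hz₂' : z₂ - ys = (z₁ - ys) + Sg d' := by rw [hz₂]; abel
  have hY : ⟪ys - w, d'⟫ = 1 / 2 * ⟪Sginv (z₁ - ys), z₁ - ys⟫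
      - 1 / 2 * ⟪Sginv (z₂ - ys), z₂ - ys⟫
      + 1 / 2 * ⟪Sg (d' - d), d' - d⟫ - 1 / 2 * ⟪Sg d, d⟫ := by
    rw [hz₂', show ys - w = -(z₁ - ys) - Sg d by rw [hw']; abel]
    have h1 : ⟪Sginv (z₁ - ys), Sg d'⟫ = ⟪z₁ - ys, d'⟫ := by rw [hSginvsa, hSginv]
    have h2 : ⟪d', Sg d'⟫ = ⟪Sg d', d'⟫ := real_inner_comm _ _
    have h3 : ⟪d', z₁ - ys⟫ = ⟪z₁ - ys, d'⟫ := real_inner_comm _ _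
    have h4 : ⟪Sg d', d⟫ = ⟪Sg d, d'⟫ := by rw [hSgsa, real_inner_comm]
    clear_value d d'
    simp only [map_add, hSginv, map_sub Sg]
    generalize z₁ - ys = a at *
    simp only [inner_add_left, inner_add_right, inner_sub_left, inner_sub_right, inner_neg_left,
      h1, h2, h3, h4]
    ring
  have hsplit : ⟪ys, A x' - A xs⟫ = ⟪w, A x' - A xs⟫ + ⟪ys - w, d'⟫ + ⟪ys - w, b - A xs⟫ := by
    rw [add_assoc, ← inner_add_right, show d' + (b - A xs) = A x' - A xs by rw [hd']; abel,
      ← inner_add_left]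
    simp
  have hadj : ⟪ContinuousLinearMap.adjoint A w, xs - x'⟫ = -⟪w, A x' - A xs⟫ := by
    rw [ContinuousLinearMap.adjoint_inner_left, map_sub, ← neg_sub, inner_neg_right]
  have hTn : ⟪Tinv (x' - x), xs - x'⟫ = -⟪Tinv (x' - x), x' - xs⟫ := by
    rw [← neg_sub x' xs, inner_neg_right]
  have hFs : ⟪F' x, xs - x'⟫ = ⟪F' x, xs - x⟫ - ⟪F' x, x' - x⟫ := by
    rw [← inner_sub_right, sub_sub_sub_cancel_right]
  rw [inner_sub_left, inner_sub_left, inner_neg_left, hadj, hTn, hFs] at hsub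
  simp only [Vfun]
  linarith

/-- A convex extended-real-valued function which avoids `⊥` is convex as a real function on its
effective domain. -/
lemma ERealConvex.convexOn_toReal {E : Type*} [AddCommGroup E] [Module ℝ E] {R : E → EReal}
    (hR : ERealConvex R) (hbot : ∀ x, R x ≠ ⊥) :
    ConvexOn ℝ {x | R x ≠ ⊤} (fun x => (R x).toReal) := by
  have key : ∀ x, R x ≠ ⊤ → ∀ y, R y ≠ ⊤ → ∀ a b : ℝ, 0 ≤ a → 0 ≤ b → a + b = 1 →
      R (a • x + b • y) ≤ ((a * (R x).toReal + b * (R y).toReal : ℝ) : EReal) := by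
    intro x hx y hy a b ha hb hab
    obtain rfl : b = 1 - a := by linarith
    have h := hR x y a ha (by linarith)
    rw [← EReal.coe_toReal hx (hbot x), ← EReal.coe_toReal hy (hbot y)] at h
    exact_mod_cast h
  refine ⟨fun x hx y hy a b ha hb hab => ?_, fun x hx y hy a b ha hb hab => ?_⟩
  · exact ((key x hx y hy a b ha hb hab).trans_lt (EReal.coe_lt_top _)).ne
  · have h := key x hx y hy a b ha hb hab
    have := EReal.toReal_le_toReal h (hbot _) (EReal.coe_ne_top _)
    rwa [EReal.toReal_coe] at this

/-- The Lagrangian is real wherever `R` is. -/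
lemma Lag_eq_coe {V W : Type*} [NormedAddCommGroup V] [InnerProductSpace ℝ V]
    [NormedAddCommGroup W] [InnerProductSpace ℝ W]
    {R : V → EReal} {F : V → ℝ} {A : V →L[ℝ] W} {b : W} {x : V} {y : W}
    (htop : R x ≠ ⊤) (hbot : R x ≠ ⊥) :
    Lag R F A b x y = (((R x).toReal + F x + ⟪y, A x - b⟫ : ℝ) : EReal) := by
  rw [Lag, add_assoc, EReal.coe_add (R x).toReal, EReal.coe_toReal htop hbot]

/-- The primal part of a saddle point lies in the domain of `R` and satisfies the constraint. -/
lemma IsSaddle.feasible {V W : Type*} [NormedAddCommGroup V] [InnerProductSpace ℝ V]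
    [NormedAddCommGroup W] [InnerProductSpace ℝ W]
    {R : V → EReal} {F : V → ℝ} {A : V →L[ℝ] W} {b : W} {xs : V} {ys : W}
    (h : IsSaddle R F A b (xs, ys)) (hR : ProperConvexLsc R) :
    R xs ≠ ⊤ ∧ A xs = b := by
  obtain ⟨⟨u, hu⟩, hbot, -, -⟩ := hR
  have htop : R xs ≠ ⊤ := by
    intro hxs
    have h1 := h u ys
    simp only [Lag_eq_coe hu (hbot u)] at h1
    rw [Lag, hxs, EReal.top_add_coe, top_le_iff] at h1
    exact EReal.coe_ne_top _ h1
  refine ⟨htop, ?_⟩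
  have h1 := h xs (ys + (A xs - b))
  simp only [Lag_eq_coe htop (hbot xs), EReal.coe_le_coe_iff, inner_add_left] at h1
  have h2 : ⟪A xs - b, A xs - b⟫ ≤ 0 := by linarith
  rw [real_inner_self_eq_norm_sq] at h2
  exact sub_eq_zero.1 (norm_eq_zero.1 (pow_eq_zero_iff two_ne_zero |>.1
    (le_antisymm h2 (sq_nonneg _))))

/-- Convexity bound for the Lagrangian at an averaged point. -/
lemma Lag_average_le {V W : Type*} [NormedAddCommGroup V] [InnerProductSpace ℝ V]
    [NormedAddCommGroup W] [InnerProductSpace ℝ W]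
    {R : V → EReal} (hR : ProperConvexLsc R) {F : V → ℝ}
    (hF : ConvexOn ℝ Set.univ F) (A : V →L[ℝ] W) (b y : W) {K : ℕ} (hK : 0 < K) {x : ℕ → V}
    (hx : ∀ j ∈ Finset.Icc 1 K, R (x j) ≠ ⊤) :
    R ((K : ℝ)⁻¹ • ∑ j ∈ Finset.Icc 1 K, x j) ≠ ⊤ ∧
    (R ((K : ℝ)⁻¹ • ∑ j ∈ Finset.Icc 1 K, x j)).toReal
        + F ((K : ℝ)⁻¹ • ∑ j ∈ Finset.Icc 1 K, x j)
        + ⟪y, A ((K : ℝ)⁻¹ • ∑ j ∈ Finset.Icc 1 K, x j) - b⟫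
      ≤ (K : ℝ)⁻¹ * ∑ j ∈ Finset.Icc 1 K, ((R (x j)).toReal + F (x j) + ⟪y, A (x j) - b⟫) := by
  have hRc := hR.2.2.1.convexOn_toReal hR.2.1
  have hlin : ConvexOn ℝ {x | R x ≠ ⊤} (fun x => ⟪y, A x - b⟫) := by
    refine ⟨hRc.1, fun u _ v _ s t _ _ hst => le_of_eq ?_⟩
    simp only [map_add, map_smul, inner_add_right, inner_sub_right, real_inner_smul_right,
      smul_eq_mul]
    linear_combination ⟪y, b⟫ * hst
  have hconv := (hRc.add (hF.subset (Set.subset_univ _) hRc.1)).add hlin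
  have hw0 : ∀ j ∈ Finset.Icc 1 K, (0 : ℝ) ≤ (K : ℝ)⁻¹ := fun _ _ => by positivity
  have hw1 : ∑ _j ∈ Finset.Icc 1 K, (K : ℝ)⁻¹ = 1 := by
    have : (K : ℝ) ≠ 0 := by positivity
    simp [this]
  rw [Finset.smul_sum, Finset.mul_sum]
  exact ⟨hRc.1.sum_mem hw0 hw1 hx, hconv.map_sum_le hw0 hw1 hx⟩

/-- Squared residual of an average, in terms of the squared residuals for perturbed data. -/
lemma norm_sq_average_residual_le {V W : Type*} [NormedAddCommGroup V] [InnerProductSpace ℝ V]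
    [NormedAddCommGroup W] [InnerProductSpace ℝ W]
    (A : V →L[ℝ] W) (b c : W) {K : ℕ} (hK : 0 < K) (x : ℕ → V) :
    ‖A ((K : ℝ)⁻¹ • ∑ j ∈ Finset.Icc 1 K, x j) - c‖ ^ 2
      ≤ 2 * ((K : ℝ)⁻¹ * ∑ j ∈ Finset.Icc 1 K, ‖A (x j) - b‖ ^ 2) + 2 * ‖b - c‖ ^ 2 := by
  have hK' : (0 : ℝ) < K := by exact_mod_cast hK
  have heq : A ((K : ℝ)⁻¹ • ∑ j ∈ Finset.Icc 1 K, x j) - c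
      = (K : ℝ)⁻¹ • ∑ j ∈ Finset.Icc 1 K, (A (x j) - b) + (b - c) := by
    rw [Finset.sum_sub_distrib, smul_sub, map_smul, map_sum]
    simp [← Nat.cast_smul_eq_nsmul ℝ, smul_smul, inv_mul_cancel₀ hK'.ne']
  have hmean : ‖(K : ℝ)⁻¹ • ∑ j ∈ Finset.Icc 1 K, (A (x j) - b)‖ ^ 2
      ≤ (K : ℝ)⁻¹ * ∑ j ∈ Finset.Icc 1 K, ‖A (x j) - b‖ ^ 2 := by
    have h1 : ‖∑ j ∈ Finset.Icc 1 K, (A (x j) - b)‖ ^ 2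
        ≤ K * ∑ j ∈ Finset.Icc 1 K, ‖A (x j) - b‖ ^ 2 := by
      refine (pow_le_pow_left₀ (norm_nonneg _) (norm_sum_le _ _) 2).trans ?_
      simpa using sq_sum_le_card_mul_sum_sq (s := Finset.Icc 1 K) (f := fun j => ‖A (x j) - b‖)
    rw [norm_smul, Real.norm_of_nonneg (by positivity), mul_pow]
    calc (K : ℝ)⁻¹ ^ 2 * ‖∑ j ∈ Finset.Icc 1 K, (A (x j) - b)‖ ^ 2
        ≤ (K : ℝ)⁻¹ ^ 2 * (K * ∑ j ∈ Finset.Icc 1 K, ‖A (x j) - b‖ ^ 2) := by gcongr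
      _ = (K : ℝ)⁻¹ * ∑ j ∈ Finset.Icc 1 K, ‖A (x j) - b‖ ^ 2 := by field_simp
  rw [heq]
  set p := (K : ℝ)⁻¹ • ∑ j ∈ Finset.Icc 1 K, (A (x j) - b)
  have h2 := norm_add_le p (b - c)
  nlinarith [sq_nonneg (‖p‖ - ‖b - c‖), norm_nonneg (p + (b - c))]

/-- A quadratic with a linear right-hand side bounds its argument. -/
lemma le_mul_add_one_of_sq_le {c B a M : ℝ} (hc : 0 < c) (hB : 0 ≤ B) (ha : 0 ≤ a)
    (h : M ^ 2 ≤ c * (B + a * M)) : M ≤ c * (B + a) + 1 := by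
  by_contra! hM
  have h1 : 0 ≤ c * (B + a) := by positivity
  have h2 : c * B ≤ c * B * M := le_mul_of_one_le_right (by positivity) (by linarith)
  nlinarith

/-- Summing a perturbed energy decrease. -/
lemma add_sum_range_le_of_step {W g : ℕ → ℝ} {c : ℝ} {K : ℕ}
    (h : ∀ n < K, W (n + 1) + g n ≤ W n + c) :
    ∀ n ≤ K, W n + ∑ k ∈ Finset.range n, g k ≤ W 0 + n * c := by
  intro n
  induction n with
  | zero => simp
  | succ n ih =>
    intro hn
    have h1 := ih (by omega)
    have h2 := h n (by omega)
    rw [Finset.sum_range_succ]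
    push_cast
    linarith

/-- Early stopping: for every `C̃ > 0` there are constants `C, C', C'' ≥ 0`,
independent of `δ`, such that for every `0 < δ ≤ C̃`, stopping at `k = ⌈C̃/δ⌉` gives
`L_{b*}(x̂_k, y*) - L_{b*}(x*, ŷ_k) ≤ C δ` and `‖A x̂_k - b*‖² ≤ C' δ + C'' δ²`. -/
theorem statement_4
    (A : X →L[ℝ] Y) (bstar : Y)
    (R : X → EReal) (hR : ProperConvexLsc R)
    (F : X → ℝ) (F' : X → X) (L : ℝ) (hL : 0 ≤ L)
    (hFconv : ConvexOn ℝ Set.univ F)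
    (hFgrad : ∀ u : X, HasGradientAt F (F' u) u)
    (hFlip : ∀ u v : X, ‖F' u - F' v‖ ≤ L * ‖u - v‖)
    (T Tinv : X →L[ℝ] X) (Sg Sginv : Y →L[ℝ] Y)
    (hTinv : ∀ u, Tinv (T u) = u) (hTinv' : ∀ u, T (Tinv u) = u)
    (hSginv : ∀ v, Sginv (Sg v) = v) (hSginv' : ∀ v, Sg (Sginv v) = v)
    (hTsa : ∀ u v : X, ⟪T u, v⟫ = ⟪u, T v⟫)
    (hSgsa : ∀ u v : Y, ⟪Sg u, v⟫ = ⟪u, Sg v⟫)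
    (τm τM σm σM : ℝ) (hτm : 0 < τm) (hττ : τm ≤ τM) (hσm : 0 < σm) (hσσ : σm ≤ σM)
    (hTb : ∀ u : X, τm * ‖u‖ ^ 2 ≤ ⟪T u, u⟫ ∧ ⟪T u, u⟫ ≤ τM * ‖u‖ ^ 2)
    (hSgb : ∀ v : Y, σm * ‖v‖ ^ 2 ≤ ⟪Sg v, v⟫ ∧ ⟪Sg v, v⟫ ≤ σM * ‖v‖ ^ 2)
    (hω : 0 ≤ 1 - τM * (L + σM * ‖A‖ ^ 2))
    (ξ η : ℝ) (hξ0 : 0 < ξ) (hξ1 : ξ < 1) (hη : 1 < η)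
    (hθ : 0 ≤ ξ - τM * (ξ * L + σM * ‖A‖ ^ 2))
    (hρ : 0 < σm * (η - 1) - σM * ξ * η)
    (xstar : X) (ystar : Y) (hsaddle : IsSaddle R F A bstar (xstar, ystar))
    (C₀ : ℝ) (hC₀ : 0 ≤ C₀)
    (x₀ : X) (ym1 : Y) :
    ∀ Ctil : ℝ, 0 < Ctil →
    ∃ C C' C'' : ℝ, 0 ≤ C ∧ 0 ≤ C' ∧ 0 ≤ C'' ∧
      ∀ δ : ℝ, 0 < δ → δ ≤ Ctil →
      ∀ bδ : Y, ‖bδ - bstar‖ ≤ δ →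
      ∀ ε : ℕ → ℝ, (∀ k, 0 ≤ ε k ∧ ε k ≤ C₀ * δ) →
      ∀ x : ℕ → X, ∀ y : ℕ → Y,
        x 0 = x₀ →
        y 0 = ym1 + Sg (A x₀ - bδ) →
        (∀ k : ℕ,
          -(Tinv (x (k + 1) - x k)) - F' (x k)
              - ContinuousLinearMap.adjoint A
                  ((2 : ℝ) • y k - (if k = 0 then ym1 else y (k - 1)))
            ∈ epsSubdiff R (ε (k + 1)) (x (k + 1))) →
        (∀ k : ℕ, y (k + 1) = y k + Sg (A (x (k + 1)) - bδ)) →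
        Lag R F A bstar ((⌈Ctil / δ⌉₊ : ℝ)⁻¹ • ∑ j ∈ Finset.Icc 1 ⌈Ctil / δ⌉₊, x j) ystar
            - Lag R F A bstar xstar
                ((⌈Ctil / δ⌉₊ : ℝ)⁻¹ • ∑ j ∈ Finset.Icc 1 ⌈Ctil / δ⌉₊, y j)
          ≤ ((C * δ : ℝ) : EReal) ∧
        ‖A ((⌈Ctil / δ⌉₊ : ℝ)⁻¹ • ∑ j ∈ Finset.Icc 1 ⌈Ctil / δ⌉₊, x j) - bstar‖ ^ 2
          ≤ C' * δ + C'' * δ ^ 2 := by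
  intro Ctil hCtil
  obtain ⟨hxtop, rfl⟩ := hsaddle.feasible hR
  have hbot := hR.2.1
  have hτM : 0 < τM := hτm.trans_le hττ
  have hσM : 0 < σM := hσm.trans_le hσσ
  have hTinvsa : ∀ u v : X, ⟪Tinv u, v⟫ = ⟪u, Tinv v⟫ := fun u v => by
    rw [← hTinv' v, ← hTsa, hTinv', hTinv]
  have hSginvsa : ∀ u v : Y, ⟪Sginv u, v⟫ = ⟪u, Sginv v⟫ := fun u v => by
    rw [← hSginv' v, ← hSgsa, hSginv', hSginv]
  have hTinvlow : ∀ u : X, ‖u‖ ^ 2 ≤ τM * ⟪Tinv u, u⟫ := fun u => by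
    have h := norm_sq_apply_le_of_form_le hTsa hτM
      (fun u => (by positivity : 0 ≤ τm * ‖u‖ ^ 2).trans (hTb u).1) (fun u => (hTb u).2) (Tinv u)
    rwa [hTinv', real_inner_comm] at h
  have hSginvlow : ∀ v : Y, ‖v‖ ^ 2 ≤ σM * ⟪Sginv v, v⟫ := fun v => by
    have h := norm_sq_apply_le_of_form_le hSgsa hσM
      (fun u => (by positivity : 0 ≤ σm * ‖u‖ ^ 2).trans (hSgb u).1) (fun u => (hSgb u).2) (Sginv v)
    rwa [hSginv', real_inner_comm] at h
  have hTinvpos : ∀ u : X, 0 ≤ ⟪Tinv u, u⟫ := fun u =>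
    nonneg_of_mul_nonneg_right ((sq_nonneg ‖u‖).trans (hTinvlow u)) hτM
  have hbracket : ∀ u : X, L * ‖u‖ ^ 2 + ⟪Sg (A u), A u⟫ ≤ ⟪Tinv u, u⟫ := fun u => by
    have h1 := (hSgb (A u)).2
    have h2 : ‖A u‖ ^ 2 ≤ ‖A‖ ^ 2 * ‖u‖ ^ 2 := by
      rw [← mul_pow]; exact pow_le_pow_left₀ (norm_nonneg _) (A.le_opNorm u) 2
    have h3 := mul_le_mul_of_nonneg_left h2 hσM.le
    have h4 := hTinvlow u
    have h5 : τM * (L * ‖u‖ ^ 2 + ⟪Sg (A u), A u⟫) ≤ τM * ⟪Tinv u, u⟫ := by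
      refine le_trans ?_ h4
      calc τM * (L * ‖u‖ ^ 2 + ⟪Sg (A u), A u⟫)
          ≤ τM * (L * ‖u‖ ^ 2 + σM * (‖A‖ ^ 2 * ‖u‖ ^ 2)) := by gcongr; linarith
        _ = τM * (L + σM * ‖A‖ ^ 2) * ‖u‖ ^ 2 := by ring
        _ ≤ 1 * ‖u‖ ^ 2 := by gcongr; linarith
        _ = ‖u‖ ^ 2 := one_mul _
    exact le_of_mul_le_mul_left h5 hτM
  obtain ⟨N, hN⟩ : ∃ N, N = ‖ym1 - ystar‖ + ‖Sg‖ * (‖A x₀ - A xstar‖ + Ctil) := ⟨_, rfl⟩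
  obtain ⟨B₀, hB₀⟩ : ∃ B, B = 1 / 2 * ⟪Tinv (x₀ - xstar), x₀ - xstar⟫
    + 1 / 2 * (‖Sginv‖ * N ^ 2) := ⟨_, rfl⟩
  have hB₀0 : 0 ≤ B₀ := by
    have := hTinvpos (x₀ - xstar)
    rw [hB₀]; positivity
  obtain ⟨M₀, hM₀⟩ : ∃ M, M = ‖ym1 - ystar‖
    + (2 * σM * (B₀ + 2 * Ctil * C₀ + 6 * Ctil) + 1) := ⟨_, rfl⟩
  have hM₀0 : 0 ≤ M₀ := by rw [hM₀]; positivity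
  obtain ⟨E, hE⟩ : ∃ E, E = B₀ + 2 * Ctil * (C₀ + 3 * M₀) := ⟨_, rfl⟩
  have hE0 : 0 ≤ E := by rw [hE]; positivity
  obtain ⟨E₂, hE₂⟩ : ∃ E₂, E₂ = 2 * E / σm + (2 * M₀ / σm) ^ 2 := ⟨_, rfl⟩
  have hE₂0 : 0 ≤ E₂ := by rw [hE₂]; positivity
  refine ⟨E / Ctil, 2 * E₂ / Ctil, 2, by positivity, by positivity, by norm_num, ?_⟩
  intro δ hδ hδC bδ hb ε hε x y hx0 hy0 hprimal hdual
  obtain ⟨K, hKdef⟩ : ∃ K, K = ⌈Ctil / δ⌉₊ := ⟨_, rfl⟩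
  rw [← hKdef]
  have hratio : 1 ≤ Ctil / δ := (one_le_div hδ).2 hδC
  have hKlow : Ctil / δ ≤ K := hKdef ▸ Nat.le_ceil _
  have hKup : (K : ℝ) * δ ≤ 2 * Ctil := by
    have h : (K : ℝ) < Ctil / δ + 1 := hKdef ▸ Nat.ceil_lt_add_one (by linarith)
    calc (K : ℝ) * δ ≤ 2 * (Ctil / δ) * δ := by gcongr; linarith
      _ = 2 * Ctil := by field_simp
  have hKpos' : (0 : ℝ) < K := by linarith
  have hKpos : 0 < K := by exact_mod_cast hKpos'
  have hKinv : (K : ℝ)⁻¹ ≤ δ / Ctil := by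
    rw [← inv_div]; exact inv_anti₀ (by positivity) hKlow
  -- dual iterates, reindexed so that the sequence starts at `ym1`
  set z : ℕ → Y := fun k => if k = 0 then ym1 else y (k - 1) with hz
  have hz0 : z 0 = ym1 := rfl
  have hzs : ∀ k, z (k + 1) = y k := fun k => by simp [hz]
  have hzstep : ∀ k, z (k + 1) = z k + Sg (A (x k) - bδ) := by
    intro k
    cases k with
    | zero => rw [hzs, hy0, hz0, hx0]
    | succ k => rw [hzs, hzs, hdual]
  set g : X → ℝ := fun u => (R u).toReal + F u + ⟪ystar, A u - A xstar⟫
    - (R xstar).toReal - F xstar with hg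
  have hRtop : ∀ k, R (x (k + 1)) ≠ ⊤ := by
    intro k hk
    have h := hprimal k xstar
    rw [hk, EReal.top_add_coe, top_le_iff] at h
    exact hxtop h
  have hgnonneg : ∀ k, 0 ≤ g (x (k + 1)) := by
    intro k
    have h := hsaddle (x (k + 1)) ystar
    simp only [Lag_eq_coe hxtop (hbot _), Lag_eq_coe (hRtop k) (hbot _),
      EReal.coe_le_coe_iff, sub_self, inner_zero_right] at h
    simp only [hg]
    linarith
  set W : ℕ → ℝ := fun n => Vfun Tinv Sginv (x n - xstar, z (n + 1) - ystar) with hW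
  have hWlow : ∀ n, ‖z (n + 1) - ystar‖ ^ 2 ≤ 2 * σM * W n := by
    intro n
    have h1 := hSginvlow (z (n + 1) - ystar)
    have h2 := mul_nonneg hσM.le (hTinvpos (x n - xstar))
    simp only [hW, Vfun]
    linarith
  have hWnonneg : ∀ n, 0 ≤ W n := fun n =>
    nonneg_of_mul_nonneg_right ((sq_nonneg _).trans (hWlow n)) (by positivity)
  have hW0 : W 0 ≤ B₀ := by
    have h1 : ‖z 1 - ystar‖ ≤ N := by
      rw [hzstep 0, hz0, hx0, hN, add_sub_right_comm]
      refine (norm_add_le _ _).trans (add_le_add_right ?_ _)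
      refine (Sg.le_opNorm _).trans (mul_le_mul_of_nonneg_left ?_ (norm_nonneg _))
      rw [show A x₀ - bδ = (A x₀ - A xstar) - (bδ - A xstar) by abel]
      exact (norm_sub_le _ _).trans (by linarith)
    have h2 : ⟪Sginv (z 1 - ystar), z 1 - ystar⟫ ≤ ‖Sginv‖ * N ^ 2 := by
      calc ⟪Sginv (z 1 - ystar), z 1 - ystar⟫
          ≤ ‖Sginv (z 1 - ystar)‖ * ‖z 1 - ystar‖ := real_inner_le_norm _ _
        _ ≤ ‖Sginv‖ * ‖z 1 - ystar‖ * ‖z 1 - ystar‖ := by gcongr; exact Sginv.le_opNorm _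
        _ = ‖Sginv‖ * ‖z 1 - ystar‖ ^ 2 := by ring
        _ ≤ ‖Sginv‖ * N ^ 2 := by gcongr
    simp only [hW, Vfun, hx0, zero_add]
    rw [hB₀]
    linarith
  have henergy : ∀ M, (∀ j ≤ K + 1, ‖z j - ystar‖ ≤ M) → ∀ n ≤ K,
      W n + ∑ k ∈ Finset.range n, (g (x (k + 1)) + σm / 2 * ‖A (x k) - bδ‖ ^ 2)
        ≤ B₀ + 2 * Ctil * (C₀ + 3 * M) := by
    intro M hM n hn
    have hM0 : 0 ≤ M := (norm_nonneg _).trans (hM 0 (by omega))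
    have hsum := add_sum_range_le_of_step (W := W)
      (g := fun k => g (x (k + 1)) + σm / 2 * ‖A (x k) - bδ‖ ^ 2)
      (c := (C₀ + 3 * M) * δ) (K := K) (by
        intro k hk
        have hsub := hprimal k xstar
        rw [← EReal.coe_toReal hxtop (hbot xstar),
          ← EReal.coe_toReal (hRtop k) (hbot _)] at hsub
        have hsub' := EReal.coe_le_coe_iff.1 ((EReal.coe_add _ _).trans_le hsub)
        rw [← hzs k] at hsub'
        have hs := primalDual_energy_step hFconv hFgrad hFlip hSginv hTinvsa hSgsa hSginvsa
          hbracket (ys := ystar) (hzstep k) (hzstep (k + 1)) hsub'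
        have hcross : ⟪ystar - ((2 : ℝ) • z (k + 1) - z k), bδ - A xstar⟫ ≤ 3 * M * δ := by
          have h1 : ‖ystar - ((2 : ℝ) • z (k + 1) - z k)‖ ≤ 3 * M := by
            rw [show ystar - ((2 : ℝ) • z (k + 1) - z k)
              = (z k - ystar) - (z (k + 1) - ystar) - (z (k + 1) - ystar) by
                rw [two_smul]; abel]
            have h2 := hM k (by omega)
            have h3 := hM (k + 1) (by omega)
            have h4 := norm_sub_le (z k - ystar) (z (k + 1) - ystar)
            have h5 := norm_sub_le ((z k - ystar) - (z (k + 1) - ystar)) (z (k + 1) - ystar)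
            linarith
          exact (real_inner_le_norm _ _).trans
            (mul_le_mul h1 hb (norm_nonneg _) (by positivity))
        have hlow := (hSgb (A (x k) - bδ)).1
        have hεk := (hε (k + 1)).2
        simp only [hW, hg]
        linarith) n hn
    have hn' : (n : ℝ) * δ ≤ 2 * Ctil :=
      (mul_le_mul_of_nonneg_right (by exact_mod_cast hn) hδ.le).trans hKup
    have hfin : (n : ℝ) * δ * (C₀ + 3 * M) ≤ 2 * Ctil * (C₀ + 3 * M) := by gcongr
    linarith
  have hterm : ∀ k, 0 ≤ g (x (k + 1)) + σm / 2 * ‖A (x k) - bδ‖ ^ 2 := fun k =>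
    add_nonneg (hgnonneg k) (by positivity)
  have hzM₀ : ∀ j ≤ K + 1, ‖z j - ystar‖ ≤ M₀ := by
    obtain ⟨m, hm, hmax⟩ := Finset.exists_max_image (Finset.range (K + 2))
      (fun j => ‖z j - ystar‖) ⟨0, by simp⟩
    have hmax' : ∀ j ≤ K + 1, ‖z j - ystar‖ ≤ ‖z m - ystar‖ := fun j hj =>
      hmax j (Finset.mem_range.2 (by omega))
    refine fun j hj => (hmax' j hj).trans ?_
    cases m with
    | zero =>
      have : 0 ≤ 2 * σM * (B₀ + 2 * Ctil * C₀ + 6 * Ctil) := by positivity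
      rw [hz0, hM₀]
      linarith
    | succ m =>
      have h1 := henergy _ hmax' m (by have := Finset.mem_range.1 hm; omega)
      have h2 := Finset.sum_nonneg (s := Finset.range m) (fun k _ => hterm k)
      have h3 := le_mul_add_one_of_sq_le (c := 2 * σM) (B := B₀ + 2 * Ctil * C₀)
        (a := 6 * Ctil) (M := ‖z (m + 1) - ystar‖) (by positivity) (by positivity)
        (by positivity)
        ((hWlow m).trans (mul_le_mul_of_nonneg_left (by linarith) (by positivity)))
      rw [hM₀]
      linarith [norm_nonneg (ym1 - ystar)]
  have htotal := henergy M₀ hzM₀ K le_rfl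
  rw [← hE, Finset.sum_add_distrib, ← Finset.mul_sum] at htotal
  have hshift : ∀ f : ℕ → ℝ, ∑ j ∈ Finset.Icc 1 K, f j = ∑ k ∈ Finset.range K, f (k + 1) := by
    intro f
    rw [← Finset.Ico_add_one_right_eq_Icc, Finset.sum_Ico_eq_sum_range]
    simp [add_comm]
  have hgsum : ∑ k ∈ Finset.range K, g (x (k + 1)) ≤ E := by
    have : 0 ≤ σm / 2 * ∑ k ∈ Finset.range K, ‖A (x k) - bδ‖ ^ 2 := by positivity
    linarith [hWnonneg K]
  have hdsum : ∑ j ∈ Finset.Icc 1 K, ‖A (x j) - bδ‖ ^ 2 ≤ E₂ := by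
    have h1 : ∑ k ∈ Finset.range K, ‖A (x k) - bδ‖ ^ 2 ≤ 2 * E / σm := by
      rw [le_div_iff₀ hσm]
      have := Finset.sum_nonneg (s := Finset.range K) (fun k _ => hgnonneg k)
      linarith [hWnonneg K]
    have h2 : ‖A (x K) - bδ‖ ≤ 2 * M₀ / σm := by
      rw [le_div_iff₀ hσm]
      have h3 : ‖Sg (A (x K) - bδ)‖ ≤ 2 * M₀ := by
        rw [show Sg (A (x K) - bδ) = (z (K + 1) - ystar) - (z K - ystar) by
          rw [hzstep K]; abel]
        have h4 := norm_sub_le (z (K + 1) - ystar) (z K - ystar)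
        linarith [hzM₀ (K + 1) le_rfl, hzM₀ K (by omega)]
      have h5 := (hSgb (A (x K) - bδ)).1.trans (real_inner_le_norm _ _)
      rcases (norm_nonneg (A (x K) - bδ)).eq_or_lt with h6 | h6
      · rw [← h6]; linarith
      · refine le_trans ?_ h3
        refine le_of_mul_le_mul_right ?_ h6
        linarith
    have h3 := pow_le_pow_left₀ (norm_nonneg _) h2 2
    have h4 := Finset.sum_range_succ' (fun k => ‖A (x k) - bδ‖ ^ 2) K
    rw [Finset.sum_range_succ] at h4
    rw [hshift, hE₂]
    linarith [sq_nonneg ‖A (x 0) - bδ‖]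
  constructor
  · obtain ⟨htop, hle⟩ := Lag_average_le hR hFconv A (A xstar) ystar hKpos (x := x) (by
      intro j hj
      obtain ⟨k, rfl⟩ := Nat.exists_eq_add_of_le' (Finset.mem_Icc.1 hj).1
      exact hRtop k)
    rw [Lag_eq_coe htop (hbot _), Lag_eq_coe hxtop (hbot _), ← EReal.coe_sub,
      EReal.coe_le_coe_iff, sub_self, inner_zero_right, add_zero]
    have hgs : ∑ j ∈ Finset.Icc 1 K, g (x j)
        = ∑ j ∈ Finset.Icc 1 K, ((R (x j)).toReal + F (x j) + ⟪ystar, A (x j) - A xstar⟫)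
          - K * ((R xstar).toReal + F xstar) := by
      simp only [hg, sub_sub, Finset.sum_sub_distrib]
      simp [mul_add]
    have hmean : (K : ℝ)⁻¹ * ∑ j ∈ Finset.Icc 1 K, g (x j) ≤ E / Ctil * δ := by
      rw [hshift]
      calc (K : ℝ)⁻¹ * ∑ k ∈ Finset.range K, g (x (k + 1)) ≤ δ / Ctil * E :=
            mul_le_mul hKinv hgsum (Finset.sum_nonneg fun k _ => hgnonneg k) (by positivity)
        _ = E / Ctil * δ := by ring
    rw [hgs, mul_sub, inv_mul_cancel_left₀ hKpos'.ne'] at hmean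
    linarith
  · refine (norm_sq_average_residual_le A bδ (A xstar) hKpos x).trans ?_
    have h1 : (K : ℝ)⁻¹ * ∑ j ∈ Finset.Icc 1 K, ‖A (x j) - bδ‖ ^ 2 ≤ δ / Ctil * E₂ := by gcongr
    have h2 := pow_le_pow_left₀ (norm_nonneg _) hb 2
    calc _ ≤ 2 * (δ / Ctil * E₂) + 2 * δ ^ 2 := by linarith
      _ = 2 * E₂ / Ctil * δ + 2 * δ ^ 2 := by ring
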